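/- Let 1 ≤ p < q < ∞. There exists no map f : ℓ_q → ℓ_p which is simultaneously weakly sequentially continuous, coarse, and satisfies Property (*). -/

import Mathlib

open Filter

/-- A map between normed spaces is *coarse* if points at distance at most `t`
are mapped to points at uniformly bounded distance. -/
def Coarse {X Y : Type*} [NormedAddCommGroup X] [NormedAddCommGroup Y]
    (f : X → Y) : Prop :=
  ∀ t : ℝ, 0 ≤ t → ∃ C : ℝ, ∀ x y : X, ‖x - y‖ ≤ t → ‖f x - f y‖ ≤ C

/-- Property (*): there are `0 < α < β` and `b > 0` such that points at distance
in `[α, β]` are mapped to points at distance at least `b`. -/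
def PropertyStar {X Y : Type*} [NormedAddCommGroup X] [NormedAddCommGroup Y]
    (f : X → Y) : Prop :=
  ∃ α β b : ℝ, 0 < α ∧ α < β ∧ 0 < b ∧
    ∀ x y : X, α ≤ ‖x - y‖ → ‖x - y‖ ≤ β → b ≤ ‖f x - f y‖

/-- A map is weakly sequentially continuous if it sends weakly convergent
sequences to weakly convergent sequences. -/
def WeakSeqCont {X Y : Type*} [NormedAddCommGroup X] [NormedSpace ℝ X]
    [NormedAddCommGroup Y] [NormedSpace ℝ Y] (f : X → Y) : Prop :=
  ∀ (x : ℕ → X) (x₀ : X),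
    (∀ φ : X →L[ℝ] ℝ, Tendsto (fun n => φ (x n)) atTop (nhds (φ x₀))) →
    ∀ ψ : Y →L[ℝ] ℝ, Tendsto (fun n => ψ (f (x n))) atTop (nhds (ψ (f x₀)))

/-- The modulus of asymptotic uniform convexity `δ̄_Y(t)`. -/
noncomputable def AUCmod (Y : Type*) [NormedAddCommGroup Y] [NormedSpace ℝ Y] (t : ℝ) : ℝ :=
  sInf { r : ℝ | ∃ x : Y, ‖x‖ = 1 ∧
    r = sSup { s : ℝ | ∃ E : Subspace ℝ Y, IsClosed (E : Set Y) ∧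
      FiniteDimensional ℝ (Y ⧸ E) ∧
      s = sInf { u : ℝ | ∃ y : Y, y ∈ E ∧ ‖y‖ = 1 ∧ u = ‖x + t • y‖ - 1 } } }

/-- `(e_n)` in `S` is a spreading model of the bounded sequence `(x_n)` in `X`. -/
def IsSpreadingModel {X S : Type*} [NormedAddCommGroup X] [NormedSpace ℝ X]
    [NormedAddCommGroup S] [NormedSpace ℝ S] (x : ℕ → X) (e : ℕ → S) : Prop :=
  ∀ ε : ℝ, 0 < ε → ∀ k : ℕ, ∃ ℓ : ℕ, ∀ n : Fin k → ℕ,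
    StrictMono n → (∀ i, ℓ ≤ n i) → ∀ a : Fin k → ℝ, (∀ i, |a i| ≤ 1) →
      |‖∑ i, a i • x (n i)‖ - ‖∑ i, a i • e (i : ℕ)‖| ≤ ε

lemma exists_nat_mul_rpow_lt {r s A : ℝ} (hsr : s < r) (hA : 0 < A) (B : ℝ) :
    ∃ k : ℕ, 1 ≤ k ∧ B * (k : ℝ) ^ s < A * (k : ℝ) ^ r := by
  have h := (tendsto_rpow_atTop (sub_pos.2 hsr)).comp (tendsto_natCast_atTop_atTop (R := ℝ))
  obtain ⟨k, hk, hk1⟩ := ((h.eventually_gt_atTop (B / A)).and (eventually_ge_atTop 1)).exists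
  have hk0 : (0 : ℝ) < k := by exact_mod_cast hk1
  refine ⟨k, hk1, ?_⟩
  simp only [Function.comp_apply, Real.rpow_sub hk0] at hk
  have hs := Real.rpow_pos_of_pos hk0 s
  rw [div_lt_div_iff₀ hA hs] at hk
  linarith

/-- A coarse map is Lipschitz for large distances. -/
lemma Coarse.exists_norm_sub_le {X Y : Type*} [NormedAddCommGroup X] [NormedSpace ℝ X]
    [NormedAddCommGroup Y] {f : X → Y} (hf : Coarse f) :
    ∃ C : ℝ, 0 ≤ C ∧ ∀ x : X, ‖f x - f 0‖ ≤ C * (‖x‖ + 1) := by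
  obtain ⟨C, hC⟩ := hf 1 zero_le_one
  have hC0 : 0 ≤ C := by simpa using hC 0 0 (by simp)
  have key : ∀ (n : ℕ) (x : X), ‖x‖ ≤ n → ‖f x - f 0‖ ≤ n * C := by
    intro n
    induction n with
    | zero =>
      intro x hx
      have : x = 0 := by simpa using hx
      simp [this]
    | succ n ih =>
      intro x hx
      push_cast at hx ⊢
      have hn : (0 : ℝ) < n + 1 := by positivity
      set y : X := ((n : ℝ) / (n + 1)) • x with hy
      have h1 : ‖y‖ ≤ n := by
        rw [hy, norm_smul, Real.norm_of_nonneg (by positivity), div_mul_eq_mul_div, div_le_iff₀ hn]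
        gcongr
      have h2 : ‖x - y‖ ≤ 1 := by
        have : x - y = ((1 : ℝ) / (n + 1)) • x := by
          rw [hy, eq_comm, ← sub_eq_zero]
          have : ((1 : ℝ) / (n + 1)) = 1 - (n : ℝ) / (n + 1) := by field_simp; ring
          rw [this, sub_smul, one_smul, sub_self]
        rw [this, norm_smul, Real.norm_of_nonneg (by positivity), div_mul_eq_mul_div,
          div_le_iff₀ hn]
        linarith
      have h3 := norm_add_le (f x - f y) (f y - f 0)
      rw [sub_add_sub_cancel] at h3
      linarith [hC x y h2, ih y h1]
  refine ⟨C, hC0, fun x => (key ⌈‖x‖⌉₊ x (Nat.le_ceil _)).trans ?_⟩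
  rw [mul_comm]
  gcongr
  exact (Nat.ceil_lt_add_one (norm_nonneg x)).le

section Sequences

open scoped ENNReal Topology

variable {p : ℝ≥0∞}

lemma lp.norm_sum_single_le [Fact (1 ≤ p)] (hp : 0 < p.toReal) {a : ℝ} (ha : 0 ≤ a) (c : ℕ → ℝ)
    (s : Finset ℕ) (hc : ∀ i ∈ s, ‖c i‖ ≤ a) :
    ‖(∑ i ∈ s, lp.single p i (c i) : lp (fun _ : ℕ => ℝ) p)‖ ≤
      a * (s.card : ℝ) ^ (1 / p.toReal) := by
  rw [← Real.rpow_le_rpow_iff (norm_nonneg _) (by positivity) hp, lp.norm_sum_single hp,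
    Real.mul_rpow ha (by positivity), ← Real.rpow_mul (by positivity),
    one_div_mul_cancel hp.ne', Real.rpow_one]
  calc ∑ i ∈ s, ‖c i‖ ^ p.toReal ≤ ∑ _i ∈ s, a ^ p.toReal :=
        Finset.sum_le_sum fun i hi => Real.rpow_le_rpow (norm_nonneg _) (hc i hi) hp.le
    _ = a ^ p.toReal * s.card := by simp [mul_comm]

/-- The unit vector basis of `ℓ_p` is weakly null when `1 < p < ∞`. -/
lemma lp.tendsto_apply_single [Fact (1 ≤ p)] (hp : 1 < p.toReal)
    (φ : lp (fun _ : ℕ => ℝ) p →L[ℝ] ℝ) :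
    Tendsto (fun n => φ (lp.single p n 1)) atTop (𝓝 0) := by
  rw [← Nat.cofinite_eq_atTop, Metric.tendsto_nhds]
  intro ε hε
  rw [eventually_cofinite]
  by_contra hinf
  obtain ⟨k, -, hk⟩ := exists_nat_mul_rpow_lt ((div_lt_one (by linarith)).2 hp) hε ‖φ‖
  obtain ⟨s, hs, hsk⟩ := Set.Infinite.exists_subset_card_eq hinf k
  have hbig : ∀ i ∈ s, ε ≤ |φ (lp.single p i 1)| := by
    intro i hi
    simpa [Real.dist_eq] using hs hi
  let c : ℕ → ℝ := fun i => SignType.sign (φ (lp.single p i 1))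
  have hc : ∀ i ∈ s, ‖c i‖ ≤ 1 := by
    intro i _
    simp only [c]
    cases SignType.sign (φ (lp.single p i 1)) <;> simp
  have h1 := lp.norm_sum_single_le (p := p) (by linarith) zero_le_one c s hc
  have h2 : φ (∑ i ∈ s, lp.single p i (c i)) = ∑ i ∈ s, |φ (lp.single p i 1)| := by
    rw [map_sum]
    refine Finset.sum_congr rfl fun i _ => ?_
    have : (lp.single p i (c i) : lp (fun _ : ℕ => ℝ) p) = c i • lp.single p i 1 := by
      rw [← lp.single_smul, smul_eq_mul, mul_one]
    rw [this, map_smul, smul_eq_mul, sign_mul_self]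
  have h3 := (le_abs_self _).trans (φ.le_opNorm (∑ i ∈ s, lp.single p i (c i)))
  rw [h2] at h3
  have h4 : k * ε ≤ ∑ i ∈ s, |φ (lp.single p i 1)| := by
    simpa [hsk] using Finset.card_nsmul_le_sum s _ ε hbig
  rw [one_mul, hsk] at h1
  have h5 := mul_le_mul_of_nonneg_left h1 (norm_nonneg φ)
  rw [Real.rpow_one] at hk
  linarith

/-- Perturbing `w` by a coordinatewise null sequence that is bounded below in norm increases the
`p`-th power of the norm by almost the `p`-th power of that bound. -/
lemma lp.eventually_add_lt_norm_add_rpow [Fact (1 ≤ p)] (hp : p ≠ ∞) (w : lp (fun _ : ℕ => ℝ) p)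
    (z : ℕ → lp (fun _ : ℕ => ℝ) p) (hz : ∀ i, Tendsto (fun n => z n i) atTop (𝓝 0))
    {b c : ℝ} (hb : 0 < b) (hzb : ∀ᶠ n in atTop, b ≤ ‖z n‖) (hc : c < b ^ p.toReal) :
    ∀ᶠ n in atTop, ‖w‖ ^ p.toReal + c < ‖w + z n‖ ^ p.toReal := by
  have hp0 : 0 < p.toReal := ENNReal.toReal_pos (zero_lt_one.trans_le Fact.out).ne' hp
  let P : Finset ℕ → lp (fun _ : ℕ => ℝ) p → lp (fun _ : ℕ => ℝ) p :=
    fun s v => ∑ i ∈ s, lp.single p i (v i)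
  have hlim : Tendsto (fun s : Finset ℕ => ∑ i ∈ s, ‖w i‖ ^ p.toReal +
      (max 0 (b - ‖w - P s w‖)) ^ p.toReal) atTop
      (𝓝 (‖w‖ ^ p.toReal + (max 0 (b - ‖w - w‖)) ^ p.toReal)) := by
    refine Tendsto.add (lp.hasSum_norm hp0 w) (Tendsto.rpow_const ?_ (Or.inr hp0.le))
    exact tendsto_const_nhds.max (tendsto_const_nhds.sub
      (tendsto_const_nhds.sub (lp.hasSum_single hp w)).norm)
  obtain ⟨s, hs⟩ := (hlim.eventually_const_lt (u := ‖w‖ ^ p.toReal + c)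
    (by simpa [max_eq_right hb.le] using hc)).exists
  have hPz : Tendsto (fun n => P s (z n)) atTop (𝓝 0) := by
    have : Tendsto (fun n => P s (z n)) atTop (𝓝 (∑ i ∈ s, lp.single p i (0 : ℝ))) :=
      tendsto_finsetSum _ fun i _ => ((lp.isometry_single i).continuous.tendsto 0).comp (hz i)
    simpa using this
  have hlim' : Tendsto (fun n => ∑ i ∈ s, ‖w i + z n i‖ ^ p.toReal +
      (max 0 (b - ‖w - P s w‖ - ‖P s (z n)‖)) ^ p.toReal) atTop
      (𝓝 (∑ i ∈ s, ‖w i + 0‖ ^ p.toReal +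
        (max 0 (b - ‖w - P s w‖ - ‖(0 : lp (fun _ : ℕ => ℝ) p)‖)) ^ p.toReal)) := by
    refine Tendsto.add (tendsto_finsetSum _ fun i _ => ?_)
      (Tendsto.rpow_const ?_ (Or.inr hp0.le))
    · exact (tendsto_const_nhds.add (hz i)).norm.rpow_const (Or.inr hp0.le)
    · exact tendsto_const_nhds.max (tendsto_const_nhds.sub hPz.norm)
  filter_upwards [hlim'.eventually_const_lt (u := ‖w‖ ^ p.toReal + c) (by simpa using hs), hzb]
    with n hn hbn
  refine hn.trans_le ?_
  have hsplit := lp.norm_sub_norm_compl_sub_single hp0 (w + z n) s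
  have hP : P s (w + z n) = P s w + P s (z n) := by
    simp [P, Finset.sum_add_distrib]
  have hle : b - ‖w - P s w‖ - ‖P s (z n)‖ ≤ ‖w + z n - P s (w + z n)‖ := by
    have e : z n = (w + z n - P s (w + z n)) - (w - P s w) + P s (z n) := by
      rw [hP]; abel
    have h1 := norm_add_le ((w + z n - P s (w + z n)) - (w - P s w)) (P s (z n))
    have h2 := norm_sub_le (w + z n - P s (w + z n)) (w - P s w)
    rw [← e] at h1
    linarith
  have hpow := Real.rpow_le_rpow (le_max_left _ _) (max_le (norm_nonneg _) hle) hp0.le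
  change _ - ‖w + z n - P s (w + z n)‖ ^ p.toReal = ∑ i ∈ s, ‖w i + z n i‖ ^ p.toReal at hsplit
  linarith

/-- A weakly sequentially continuous map with Property (*) maps some sum of `k` multiples of unit
vectors to distance of order at least `k ^ (1 / p)` from `f 0`. -/
lemma WeakSeqCont.exists_card_mul_le_norm_sub_rpow {q : ℝ≥0∞} [Fact (1 ≤ p)] [Fact (1 ≤ q)]
    (hp : p ≠ ∞) (hq : 1 < q.toReal)
    {f : lp (fun _ : ℕ => ℝ) q → lp (fun _ : ℕ => ℝ) p} (hf : WeakSeqCont f)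
    {a b : ℝ} (ha : 0 < a) (hb : 0 < b)
    (hab : ∀ x y, ‖x - y‖ = a → b ≤ ‖f x - f y‖) (k : ℕ) :
    ∃ s : Finset ℕ, s.card = k ∧
      k * (b ^ p.toReal / 2) ≤ ‖f (∑ i ∈ s, lp.single q i a) - f 0‖ ^ p.toReal := by
  induction k with
  | zero => exact ⟨∅, by simp, by simp; positivity⟩
  | succ k ih =>
    obtain ⟨s, hsk, hs⟩ := ih
    set x : lp (fun _ : ℕ => ℝ) q := ∑ i ∈ s, lp.single q i a with hx
    have hweak : ∀ φ : lp (fun _ : ℕ => ℝ) q →L[ℝ] ℝ,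
        Tendsto (fun n => φ (x + lp.single q n a)) atTop (𝓝 (φ x)) := by
      intro φ
      have h := (lp.tendsto_apply_single hq φ).const_mul a |>.const_add (φ x)
      rw [mul_zero, add_zero] at h
      refine h.congr fun n => ?_
      have : (lp.single q n a : lp (fun _ : ℕ => ℝ) q) = a • lp.single q n 1 := by
        rw [← lp.single_smul, smul_eq_mul, mul_one]
      rw [this, map_add, map_smul, smul_eq_mul]
    have hcoord : ∀ i, Tendsto (fun n => (f (x + lp.single q n a) - f x) i) atTop (𝓝 0) := by
      intro i
      have h : Tendsto (fun n => f (x + lp.single q n a) i) atTop (𝓝 (f x i)) :=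
        hf _ x hweak (lp.evalCLM ℝ (fun _ : ℕ => ℝ) p i)
      simpa using h.sub_const (f x i)
    have hbound : ∀ n, b ≤ ‖f (x + lp.single q n a) - f x‖ := fun n => hab _ _ <| by
      rw [add_sub_cancel_left, lp.norm_single (zero_lt_one.trans_le Fact.out),
        Real.norm_of_nonneg ha.le]
    obtain ⟨n, hn, hns⟩ := ((lp.eventually_add_lt_norm_add_rpow hp (f x - f 0) _ hcoord hb
      (.of_forall hbound) (half_lt_self (Real.rpow_pos_of_pos hb _))).and
      (Nat.cofinite_eq_atTop ▸ s.eventually_cofinite_notMem)).exists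
    refine ⟨insert n s, by rw [Finset.card_insert_of_notMem hns, hsk], ?_⟩
    rw [Finset.sum_insert hns, ← hx, add_comm (lp.single q n a) x]
    rw [add_comm (f x - f 0), sub_add_sub_cancel] at hn
    rw [Nat.cast_succ, add_one_mul]
    exact (add_le_add_left hs _).trans hn.le

end Sequences

/-- Corollary 1.7: for `1 ≤ p < q < ∞` there is no weakly sequentially
continuous map `ℓ_q → ℓ_p` which is coarse and satisfies Property (*). -/
theorem stmt5 (p q : ℝ) (hp : 1 ≤ p) (hpq : p < q)
    [Fact (1 ≤ ENNReal.ofReal p)] [Fact (1 ≤ ENNReal.ofReal q)] :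
    ¬ ∃ f : lp (fun _ : ℕ => ℝ) (ENNReal.ofReal q) → lp (fun _ : ℕ => ℝ) (ENNReal.ofReal p),
      WeakSeqCont f ∧ Coarse f ∧ PropertyStar f := by
  rintro ⟨f, hw, hc, α, β, b, hα, hαβ, hb, hf⟩
  obtain ⟨C, hC0, hC⟩ := hc.exists_norm_sub_le
  have hp0 : 0 < p := by linarith
  have hq0 : 0 < q := by linarith
  have hpr : (ENNReal.ofReal p).toReal = p := ENNReal.toReal_ofReal hp0.le
  have hqr : (ENNReal.ofReal q).toReal = q := ENNReal.toReal_ofReal hq0.le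
  have hB : 0 < b ^ p / 2 := by positivity
  obtain ⟨k, hk1, hk⟩ := exists_nat_mul_rpow_lt (one_div_lt_one_div_of_lt hp0 hpq)
    (Real.rpow_pos_of_pos hB (1 / p)) (C * (α + 1))
  obtain ⟨s, hsk, hs⟩ := hw.exists_card_mul_le_norm_sub_rpow ENNReal.ofReal_ne_top
    (by linarith) hα hb (fun x y h => hf x y h.ge (h.le.trans hαβ.le)) k
  have hnorm := lp.norm_sum_single_le (p := ENNReal.ofReal q) (by linarith) hα.le (fun _ => α) s
    (fun _ _ => (Real.norm_of_nonneg hα.le).le)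
  rw [hsk, hqr] at hnorm
  rw [hpr] at hs
  have hroot := Real.rpow_le_rpow (by positivity) hs (one_div_pos.2 hp0).le
  rw [← Real.rpow_mul (norm_nonneg _), mul_one_div_cancel hp0.ne', Real.rpow_one,
    Real.mul_rpow (by positivity) hB.le] at hroot
  have hk1' : (1 : ℝ) ≤ (k : ℝ) ^ (1 / q) :=
    Real.one_le_rpow (by exact_mod_cast hk1) (one_div_pos.2 hq0).le
  have hupper := (hC _).trans (mul_le_mul_of_nonneg_left (add_le_add hnorm hk1') hC0)
  rw [← add_one_mul] at hupper
  rw [mul_comm] at hroot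
  rw [← mul_assoc] at hupper
  exact (hroot.trans hupper).not_gt hk
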